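/- arXiv:1002.1381 — 8 statements merged into one kernel-verified Lean document; each statement's English description precedes it below -/
import Mathlib

section
/- Let V be a real normed vector space of dimension 2 and let R be the set of rotund points of V. Let a, b, p, q ∈ V and r, s ∈ ℝ be such that: a ≠ b; p ≠ q; both a and b lie in S_V(p, r) ∩ S_V(q, s); at least one of a − p, a − q is rotund; and at least one of b − p, b − q is rotund. Then S_V(p, r) ∩ S_V(q, s) = {a, b}. -/
/-- A point `v` of a real normed vector space is *rotund* if for every `u`,
`‖u‖ = ‖v‖` and `‖(u+v)/2‖ = ‖v‖` imply `u = v`. -/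
def Rotund {V : Type*} [NormedAddCommGroup V] [NormedSpace ℝ V] (v : V) : Prop :=
  ∀ u : V, ‖u‖ = ‖v‖ → ‖((1 : ℝ) / 2) • (u + v)‖ = ‖v‖ → u = v

section SphereIntersection

variable {V : Type*} [NormedAddCommGroup V] [NormedSpace ℝ V]

/-- The case where the segments from `0` to `y` and from `x` to `w` cross. -/
lemma norm_add_of_crossing {x y w : V} {r s α β : ℝ}
    (hx : ‖x‖ = r) (hy : ‖y‖ = r) (hxw : ‖x - w‖ = s) (hyw : ‖y - w‖ = s)
    (hα : 0 ≤ α) (hβ : 0 < β) (hαβ : 1 < α + β) (h : y = α • x + β • w) :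
    ‖x + y‖ = 2 * r ∧ ‖(x - w) + (y - w)‖ = 2 * s := by
  have e1 : (α + β) • x = y + β • (x - w) := by rw [h]; module
  have e2 : (α + β) • (y - w) = (α + β - 1) • y + α • (x - w) := by rw [h]; module
  have n1 : (α + β) * r ≤ r + β * s := by
    have := norm_add_le y (β • (x - w))
    rwa [← e1, norm_smul, norm_smul, Real.norm_of_nonneg (by linarith),
      Real.norm_of_nonneg hβ.le, hx, hy, hxw] at this
  have n2 : (α + β) * s ≤ (α + β - 1) * r + α * s := by
    have := norm_add_le ((α + β - 1) • y) (α • (x - w))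
    rwa [← e2, norm_smul, norm_smul, norm_smul, Real.norm_of_nonneg (by linarith),
      Real.norm_of_nonneg (by linarith), Real.norm_of_nonneg hα, hy, hxw, hyw] at this
  obtain ⟨f, hf, hfx⟩ := exists_dual_vector'' ℝ x
  have hfx' : f x = r := by simpa [hx] using hfx
  have bound : ∀ v, f v ≤ ‖v‖ := fun v =>
    (le_abs_self _).trans ((f.le_of_opNorm_le hf v).trans (one_mul _).le)
  have fy := bound y
  have fxw := bound (x - w)
  rw [hy] at fy
  rw [hxw] at fxw
  have e3 : (α + β) * r = f y + β * f (x - w) := by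
    rw [← hfx', ← smul_eq_mul, ← map_smul, e1, map_add, map_smul, smul_eq_mul]
  have m := mul_le_mul_of_nonneg_left fxw hβ.le
  have fy' : f y = r := by linarith
  have fxw' : f (x - w) = s := mul_left_cancel₀ hβ.ne' (by linarith)
  have b1 := bound (x + y)
  have b2 := bound ((x - w) + (y - w))
  have u1 := norm_add_le x y
  have u2 := norm_add_le (x - w) (y - w)
  simp only [map_add, map_sub] at b1 b2 fxw'
  constructor <;> linarith

lemma norm_add_of_eq_smul_add_smul {x y w : V} {r s α β : ℝ}
    (hx : ‖x‖ = r) (hy : ‖y‖ = r) (hxw : ‖x - w‖ = s) (hyw : ‖y - w‖ = s)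
    (hα : 0 ≤ α) (hα1 : α ≤ 1) (h : y = α • x + β • w) :
    ‖x + y‖ = 2 * r ∧ ‖(x - w) + (y - w)‖ = 2 * s := by
  rcases lt_or_ge 1 (α + β) with h1 | h1
  · exact norm_add_of_crossing hx hy hxw hyw hα (by linarith) h1 h
  rcases lt_or_ge β 0 with h2 | h2
  · have := norm_add_of_crossing (x := x - w) (y := y - w) (w := -w) (r := s) (s := r)
      (β := 1 - α - β) hxw hyw (by simpa using hx) (by simpa using hy) hα
      (by linarith) (by linarith) (by rw [h]; module)
    simpa using this.symm
  rcases hα1.eq_or_lt with rfl | hα1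
  · obtain rfl : β = 0 := by linarith
    obtain rfl : y = x := by simpa using h
    rw [← two_smul ℝ y, ← two_smul ℝ (y - w), norm_smul, norm_smul, hy, hyw]
    simp
  have n1 : r ≤ α * r + β * ‖w‖ := by
    have := norm_add_le (α • x) (β • w)
    rwa [← h, norm_smul, norm_smul, Real.norm_of_nonneg hα,
      Real.norm_of_nonneg h2, hx, hy] at this
  have n2 : s ≤ α * s + (1 - α - β) * ‖w‖ := by
    have := norm_sub_le (α • (x - w)) ((1 - α - β) • w)
    rwa [show α • (x - w) - (1 - α - β) • w = y - w by rw [h]; module, norm_smul, norm_smul,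
      Real.norm_of_nonneg hα, Real.norm_of_nonneg (by linarith), hxw, hyw] at this
  have hw : r + s ≤ ‖w‖ := le_of_mul_le_mul_left (by linarith) (sub_pos.2 hα1)
  have n3 := norm_sub_le (x + y) ((x - w) + (y - w))
  rw [show (x + y) - ((x - w) + (y - w)) = (2 : ℝ) • w by module, norm_smul,
    Real.norm_of_nonneg zero_le_two] at n3
  have u1 := norm_add_le x y
  have u2 := norm_add_le (x - w) (y - w)
  constructor <;> linarith

/-- Two common points of two spheres that lie on the same side of the line through the centres
have their midpoint on both spheres. -/
lemma norm_add_of_same_side {g : V →ₗ[ℝ] ℝ} {x y w : V} {r s : ℝ}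
    (hg : ∀ v, g v = 0 → ∃ t : ℝ, t • w = v)
    (hx : ‖x‖ = r) (hy : ‖y‖ = r) (hxw : ‖x - w‖ = s) (hyw : ‖y - w‖ = s)
    (h : 0 ≤ g x * g y) :
    ‖x + y‖ = 2 * r ∧ ‖(x - w) + (y - w)‖ = 2 * s := by
  wlog hle : |g y| ≤ |g x| generalizing x y
  · rw [add_comm x, add_comm (x - w)]
    exact this hy hx hyw hxw (by rwa [mul_comm]) (le_of_not_ge hle)
  have hα : 0 ≤ g y / g x := by
    rcases mul_nonneg_iff.1 h with ⟨h1, h2⟩ | ⟨h1, h2⟩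
    · exact div_nonneg h2 h1
    · exact div_nonneg_of_nonpos h2 h1
  have hα1 : g y / g x ≤ 1 :=
    (le_abs_self _).trans (by rw [abs_div]; exact div_le_one_of_le₀ hle (abs_nonneg _))
  have hker : g (y - (g y / g x) • x) = 0 := by
    rw [map_sub, map_smul, smul_eq_mul, div_mul_cancel_of_imp, sub_self]
    intro h0
    simpa [h0] using hle
  obtain ⟨t, ht⟩ := hg _ hker
  exact norm_add_of_eq_smul_add_smul (β := t) hx hy hxw hyw hα hα1 (by rw [ht]; module)

lemma exists_linearMap_ker_le_span_singleton (hdim : Module.finrank ℝ V = 2) {w : V}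
    (hw : w ≠ 0) : ∃ g : V →ₗ[ℝ] ℝ, ∀ v, g v = 0 → ∃ t : ℝ, t • w = v := by
  have : FiniteDimensional ℝ V := Module.finite_of_finrank_pos (by omega)
  have h1 := Submodule.finrank_quotient_add_finrank (ℝ ∙ w)
  rw [finrank_span_singleton hw, hdim] at h1
  have e : (V ⧸ (ℝ ∙ w)) ≃ₗ[ℝ] ℝ := LinearEquiv.ofFinrankEq _ _ (by simp; omega)
  refine ⟨e.toLinearMap ∘ₗ (ℝ ∙ w).mkQ, fun v hv => ?_⟩
  rw [← Submodule.mem_span_singleton]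
  simpa using hv

lemma eq_of_same_side_of_rotund {g : V →ₗ[ℝ] ℝ} {p q x y : V} {r s : ℝ}
    (hg : ∀ v, g v = 0 → ∃ t : ℝ, t • (q - p) = v)
    (hxp : ‖x - p‖ = r) (hxq : ‖x - q‖ = s) (hyp : ‖y - p‖ = r) (hyq : ‖y - q‖ = s)
    (hrot : Rotund (x - p) ∨ Rotund (x - q)) (h : 0 ≤ g (x - p) * g (y - p)) : y = x := by
  obtain ⟨h1, h2⟩ := norm_add_of_same_side hg hxp hyp (by simpa using hxq) (by simpa using hyq) h
  simp only [sub_sub_sub_cancel_right] at h2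
  rcases hrot with H | H
  · refine sub_left_injective (H (y - p) (by rw [hxp, hyp]) ?_)
    rw [add_comm, norm_smul, Real.norm_of_nonneg one_half_pos.le, h1, hxp]
    ring
  · refine sub_left_injective (H (y - q) (by rw [hxq, hyq]) ?_)
    rw [add_comm, norm_smul, Real.norm_of_nonneg one_half_pos.le, h2, hxq]
    ring

end SphereIntersection

/-- Lemma 1, the two-point lemma: in a 2-dimensional real normed space,
if distinct points `a, b` lie on the intersection of the spheres `S_V(p,r)` and
`S_V(q,s)` with `p ≠ q`, and at least one of `a - p, a - q` is rotund, and at least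
one of `b - p, b - q` is rotund, then the two spheres meet exactly in `{a, b}`. -/
theorem stmt_0 {V : Type*} [NormedAddCommGroup V] [NormedSpace ℝ V]
    (hdim : Module.finrank ℝ V = 2)
    (a b p q : V) (r s : ℝ)
    (hab : a ≠ b) (hpq : p ≠ q)
    (hap : ‖a - p‖ = r) (haq : ‖a - q‖ = s)
    (hbp : ‖b - p‖ = r) (hbq : ‖b - q‖ = s)
    (hra : Rotund (a - p) ∨ Rotund (a - q))
    (hrb : Rotund (b - p) ∨ Rotund (b - q)) :
    {x : V | ‖x - p‖ = r} ∩ {x : V | ‖x - q‖ = s} = {a, b} := by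
  obtain ⟨g, hg⟩ := exists_linearMap_ker_le_span_singleton hdim (sub_ne_zero.2 hpq.symm)
  ext c
  simp only [Set.mem_inter_iff, Set.mem_ofPred_eq, Set.mem_insert_iff, Set.mem_singleton_iff]
  constructor
  · rintro ⟨hcp, hcq⟩
    by_contra! hc
    have ab := mt (eq_of_same_side_of_rotund hg hap haq hbp hbq hra) hab.symm
    have ac := mt (eq_of_same_side_of_rotund hg hap haq hcp hcq hra) hc.1
    have bc := mt (eq_of_same_side_of_rotund hg hbp hbq hcp hcq hrb) hc.2
    rw [not_le] at ab ac bc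
    nlinarith [mul_pos_of_neg_of_neg ab ac, sq_nonneg (g (a - p))]
  · rintro (rfl | rfl)
    · exact ⟨hap, haq⟩
    · exact ⟨hbp, hbq⟩
end

section
/- Let D₁ ⊆ ℝ² be a convex body, let c > 0 be a real number and v ∈ ℝ², let f : ℝ² → ℝ² be f(x) = c•x + v, let D₂ = f(D₁), and let S₁, S₂ be the topological frontiers of D₁, D₂ respectively. Then exactly one of the following holds: (1) S₁ ∩ S₂ = ∅; (2) S₁ = S₂ (so S₁ ∩ S₂ = S₁); (3) S₁ ∩ S₂ is connected and is either (a) a single point or a proper closed line segment, or (b) the union of two proper closed line segments that share exactly one common endpoint and are not collinear; (4) S₁ ∩ S₂ has exactly two connected components, each of which is a single point or a proper closed line segment. -/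
/-- A set is a single point or a proper closed line segment. -/
def PtOrSeg (A : Set (EuclideanSpace ℝ (Fin 2))) : Prop :=
  (∃ x, A = {x}) ∨ ∃ a b : EuclideanSpace ℝ (Fin 2), a ≠ b ∧ A = segment ℝ a b

/-- Outcome 1: the frontiers are disjoint. -/
def Outcome1 (S₁ S₂ : Set (EuclideanSpace ℝ (Fin 2))) : Prop :=
  S₁ ∩ S₂ = ∅

/-- Outcome 2: the frontiers coincide. -/
def Outcome2 (S₁ S₂ : Set (EuclideanSpace ℝ (Fin 2))) : Prop :=
  S₁ = S₂

/-- Outcome 3: `S₁ ∩ S₂` is connected and is either (a) a point or a proper closed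
line segment, or (b) the union of two proper closed line segments that share
exactly one common endpoint and are not collinear. -/
def Outcome3 (S₁ S₂ : Set (EuclideanSpace ℝ (Fin 2))) : Prop :=
  IsConnected (S₁ ∩ S₂) ∧
    (PtOrSeg (S₁ ∩ S₂) ∨
      ∃ a b c : EuclideanSpace ℝ (Fin 2), a ≠ b ∧ b ≠ c ∧ a ≠ c ∧
        ¬ Collinear ℝ ({a, b, c} : Set (EuclideanSpace ℝ (Fin 2))) ∧
        S₁ ∩ S₂ = segment ℝ a b ∪ segment ℝ b c)

/-- Outcome 4: `S₁ ∩ S₂` has exactly two connected components, each of which is a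
point or a proper closed line segment. -/
def Outcome4 (S₁ S₂ : Set (EuclideanSpace ℝ (Fin 2))) : Prop :=
  ∃ A B : Set (EuclideanSpace ℝ (Fin 2)),
    A.Nonempty ∧ B.Nonempty ∧ Disjoint A B ∧ S₁ ∩ S₂ = A ∪ B ∧
      PtOrSeg A ∧ PtOrSeg B

section

open Set Topology

abbrev Plane := EuclideanSpace ℝ (Fin 2)

theorem Plane.ext_coord {x y : Plane} (h₀ : x 0 = y 0) (h₁ : x 1 = y 1) : x = y := by
  ext i
  fin_cases i <;> assumption

theorem Plane.eq_zero_of_sq_add_sq_nonpos {x : Plane} (h : x 0 ^ 2 + x 1 ^ 2 ≤ 0) : x = 0 := by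
  have h₀ : x 0 ^ 2 = 0 := by nlinarith [sq_nonneg (x 0), sq_nonneg (x 1)]
  have h₁ : x 1 ^ 2 = 0 := by nlinarith [sq_nonneg (x 0), sq_nonneg (x 1)]
  exact Plane.ext_coord (pow_eq_zero_iff two_ne_zero |>.1 h₀) (pow_eq_zero_iff two_ne_zero |>.1 h₁)

/-- A preconnected set that meets both the interior and the complement of a closed set meets its
frontier. -/
theorem IsPreconnected.nonempty_inter_frontier {X : Type*} [TopologicalSpace X] {s K : Set X}
    (hs : IsPreconnected s) (hK : IsClosed K) (hi : (s ∩ interior K).Nonempty)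
    (ho : (s ∩ Kᶜ).Nonempty) : (s ∩ frontier K).Nonempty := by
  by_contra h
  rw [not_nonempty_iff_eq_empty] at h
  have hcover : s ⊆ interior K ∪ Kᶜ := by
    intro x hx
    by_contra hx'
    simp only [mem_union, mem_compl_iff, not_or, not_not] at hx'
    have : x ∈ s ∩ frontier K := ⟨hx, by rw [hK.frontier_eq]; exact ⟨hx'.2, hx'.1⟩⟩
    simp [h] at this
  obtain ⟨x, -, hx, hx'⟩ := hs _ _ isOpen_interior hK.isOpen_compl hcover hi ho
  exact hx' (interior_subset hx)

/-- Two linear functionals on the plane are simultaneously nonpositive at some nonzero vector. -/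
theorem exists_ne_zero_nonpos_nonpos (φ ψ : Plane →L[ℝ] ℝ) :
    ∃ u : Plane, u ≠ 0 ∧ φ u ≤ 0 ∧ ψ u ≤ 0 := by
  have hker : ∃ u : Plane, u ≠ 0 ∧ φ u = 0 := by
    have : Module.finrank ℝ ℝ < Module.finrank ℝ Plane := by simp
    have h := LinearMap.ker_ne_bot_of_finrank_lt (f := (φ : Plane →ₗ[ℝ] ℝ)) this
    obtain ⟨u, hu, hu0⟩ := Submodule.exists_mem_ne_zero_of_ne_bot h
    exact ⟨u, hu0, by simpa using hu⟩
  obtain ⟨u, hu0, hu⟩ := hker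
  rcases le_total (ψ u) 0 with h | h
  · exact ⟨u, hu0, hu.le, h⟩
  · exact ⟨-u, neg_ne_zero.2 hu0, by simp [hu], by simpa using h⟩

/-- The frontier of a planar convex body is not covered by two closed convex subsets. -/
theorem frontier_ne_union_of_convex {K A B : Set Plane} (hK : IsCompact K)
    (hint : (interior K).Nonempty) (hA : Convex ℝ A) (hA' : IsClosed A) (hB : Convex ℝ B)
    (hB' : IsClosed B) : frontier K ≠ A ∪ B := by
  intro h
  obtain ⟨o, ho⟩ := hint
  have hoF : o ∉ frontier K := fun hf => hf.2 ho
  rw [h, mem_union, not_or] at hoF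
  obtain ⟨φ, a, hφo, hφ⟩ := geometric_hahn_banach_point_closed hA hA' hoF.1
  obtain ⟨ψ, b, hψo, hψ⟩ := geometric_hahn_banach_point_closed hB hB' hoF.2
  obtain ⟨u, hu, hφu, hψu⟩ := exists_ne_zero_nonpos_nonpos φ ψ
  let ray : ℝ → Plane := fun t => o + t • u
  have hray : Continuous ray := by fun_prop
  obtain ⟨R, hR⟩ := hK.isBounded.exists_norm_le
  have hfar : ∃ t : ℝ, 0 ≤ t ∧ ray t ∉ K := by
    have hu' : 0 < ‖u‖ := norm_pos_iff.2 hu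
    have hR0 : 0 ≤ R := (norm_nonneg o).trans (hR o (interior_subset ho))
    refine ⟨(R + ‖o‖ + 1) / ‖u‖, by positivity, fun hmem => ?_⟩
    have h1 := hR _ hmem
    have h2 : ‖((R + ‖o‖ + 1) / ‖u‖) • u‖ = R + ‖o‖ + 1 := by
      rw [norm_smul, Real.norm_of_nonneg (by positivity)]
      field_simp
    have h3 := norm_sub_le (o + ((R + ‖o‖ + 1) / ‖u‖) • u) o
    rw [add_sub_cancel_left, h2] at h3
    linarith
  obtain ⟨T, hT, hTK⟩ := hfar
  have hconn : IsPreconnected (ray '' Ici 0) := isPreconnected_Ici.image _ hray.continuousOn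
  obtain ⟨x, ⟨t, ht, rfl⟩, hx⟩ := hconn.nonempty_inter_frontier hK.isClosed
    ⟨o, ⟨0, self_mem_Ici, by simp [ray]⟩, ho⟩ ⟨_, ⟨T, hT, rfl⟩, hTK⟩
  have ht' : (0 : ℝ) ≤ t := ht
  rw [h] at hx
  rcases hx with hx | hx
  · have := hφ _ hx
    simp only [ray, map_add, map_smul, smul_eq_mul] at this
    nlinarith [mul_nonneg ht' (neg_nonneg.2 hφu)]
  · have := hψ _ hx
    simp only [ray, map_add, map_smul, smul_eq_mul] at this
    nlinarith [mul_nonneg ht' (neg_nonneg.2 hψu)]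

/-- A nonempty compact convex collinear set is a point or a proper segment. -/
theorem Collinear.ptOrSeg {C : Set Plane} (hcol : Collinear ℝ C) (hne : C.Nonempty)
    (hconv : Convex ℝ C) (hcomp : IsCompact C) : PtOrSeg C := by
  obtain ⟨p, hp⟩ := hne
  obtain ⟨w, hw⟩ := (collinear_iff_of_mem hp).1 hcol
  by_cases hw0 : w = 0
  · left
    refine ⟨p, Subset.antisymm (fun x hx => ?_) (by simpa using hp)⟩
    obtain ⟨r, rfl⟩ := hw x hx
    simp [hw0]
  let line : ℝ →ᵃ[ℝ] Plane := AffineMap.lineMap p (p + w)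
  have hline : ∀ r, line r = r • w + p := fun r => by simp [line, AffineMap.lineMap_apply]
  let g : Plane → ℝ := fun x => inner ℝ w (x - p) / ‖w‖ ^ 2
  have hg : Continuous g := by fun_prop
  have hwn : ‖w‖ ≠ 0 := norm_ne_zero_iff.2 hw0
  have hgl : ∀ r, g (line r) = r := fun r => by
    simp only [g, hline, add_sub_cancel_right, inner_smul_right, real_inner_self_eq_norm_sq]
    field_simp
  have hlg : ∀ x ∈ C, line (g x) = x := fun x hx => by
    obtain ⟨r, rfl⟩ := hw x hx
    rw [vadd_eq_add, ← hline, hgl]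
  have hR : g '' C = Icc (sInf (g '' C)) (sSup (g '' C)) :=
    eq_Icc_of_connected_compact ((hconv.isConnected ⟨p, hp⟩).image _ hg.continuousOn)
      (hcomp.image hg)
  have hle : sInf (g '' C) ≤ sSup (g '' C) := by
    rw [← nonempty_Icc, ← hR]
    exact ⟨_, p, hp, rfl⟩
  have hC : C = segment ℝ (line (sInf (g '' C))) (line (sSup (g '' C))) := by
    rw [← image_segment, segment_eq_Icc hle, ← hR, image_image, image_congr hlg, image_id']
  by_cases hab : line (sInf (g '' C)) = line (sSup (g '' C))
  · left
    exact ⟨_, by rwa [← hab, segment_same] at hC⟩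
  · exact Or.inr ⟨_, _, hab, hC⟩

/-- A convex set in the plane with empty interior is collinear. -/
theorem Convex.collinear_of_interior_eq_empty {C : Set Plane} (hC : Convex ℝ C)
    (h : interior C = ∅) : Collinear ℝ C := by
  rcases C.eq_empty_or_nonempty with rfl | hne
  · exact collinear_empty ℝ _
  have hspan : affineSpan ℝ C ≠ ⊤ := fun ht => by
    have := hC.interior_nonempty_iff_affineSpan_eq_top.2 ht
    simp [h] at this
  have hdir : vectorSpan ℝ C ≠ ⊤ := by
    rw [← direction_affineSpan]
    exact fun ht => hspan
      ((AffineSubspace.direction_eq_top_iff_of_nonempty ((affineSpan_nonempty ℝ).2 hne)).1 ht)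
  rw [collinear_iff_finrank_le_one]
  have := Submodule.finrank_lt hdir
  simp at this
  omega

theorem PtOrSeg.exists_segment {A : Set Plane} (h : PtOrSeg A) : ∃ a b, A = segment ℝ a b := by
  rcases h with ⟨x, rfl⟩ | ⟨a, b, -, rfl⟩
  · exact ⟨x, x, (segment_same ℝ x).symm⟩
  · exact ⟨a, b, rfl⟩

theorem ptOrSeg_segment (a b : Plane) : PtOrSeg (segment ℝ a b) := by
  by_cases h : a = b
  · exact Or.inl ⟨a, by rw [h, segment_same]⟩
  · exact Or.inr ⟨a, b, h, rfl⟩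

theorem isCompact_segment (a b : Plane) : IsCompact (segment ℝ a b) := by
  rw [segment_eq_image_lineMap]
  exact isCompact_Icc.image AffineMap.lineMap_continuous

/-- The displacement field of `x ↦ c • x + v`. -/
def drift (c : ℝ) (v x : Plane) : Plane := (c - 1) • x + v

/-- Signed side of `y` with respect to the line through `x` in the direction `drift c v x`. -/
def side (c : ℝ) (v x y : Plane) : ℝ :=
  drift c v x 0 * (y 1 - x 1) - drift c v x 1 * (y 0 - x 0)

theorem side_swap (c : ℝ) (v x y : Plane) : side c v x y = -side c v y x := by
  simp [side, drift]
  ring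

theorem side_combo_right (c : ℝ) (v x y z : Plane) {a b : ℝ} (h : a + b = 1) :
    side c v x (a • y + b • z) = a * side c v x y + b * side c v x z := by
  obtain rfl : b = 1 - a := by linarith
  simp [side]
  ring

theorem side_combo_left (c : ℝ) (v x y z : Plane) {a b : ℝ} (h : a + b = 1) :
    side c v (a • y + b • z) x = a * side c v y x + b * side c v z x := by
  rw [side_swap, side_combo_right c v x y z h, side_swap c v x y, side_swap c v x z]
  ring

theorem side_eq_zero_of_drift_eq_zero {c : ℝ} {v x : Plane} (h : drift c v x = 0) (y : Plane) :
    side c v x y = 0 := by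
  simp [side, h]

theorem side_add_smul_drift (c : ℝ) (v x : Plane) (t : ℝ) :
    side c v x (x + t • drift c v x) = 0 := by
  simp [side]
  ring

theorem continuous_side (c : ℝ) (v x : Plane) : Continuous (side c v x) := by
  unfold side
  fun_prop

theorem continuous_drift (c : ℝ) (v : Plane) : Continuous (drift c v) := by
  unfold drift
  fun_prop

theorem exists_eq_add_smul_drift {c : ℝ} {v x y : Plane} (hx : drift c v x ≠ 0)
    (h : side c v x y = 0) : ∃ t : ℝ, y = x + t • drift c v x := by
  have hsq : drift c v x 0 ^ 2 + drift c v x 1 ^ 2 ≠ 0 :=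
    fun h0 => hx (Plane.eq_zero_of_sq_add_sq_nonpos h0.le)
  unfold side at h
  refine ⟨(drift c v x 0 * (y 0 - x 0) + drift c v x 1 * (y 1 - x 1)) /
    (drift c v x 0 ^ 2 + drift c v x 1 ^ 2), Plane.ext_coord ?_ ?_⟩
  · simp only [PiLp.add_apply, PiLp.smul_apply, smul_eq_mul]
    field_simp
    linear_combination (-drift c v x 1) * h
  · simp only [PiLp.add_apply, PiLp.smul_apply, smul_eq_mul]
    field_simp
    linear_combination (drift c v x 0) * h

/-- An affine functional `side c v x` that vanishes at an interior point of a set and has constant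
sign on the set comes from a zero of the displacement field. -/
theorem drift_eq_zero_of_side_nonneg {c : ℝ} {v x z : Plane} {M : Set Plane} (hz : z ∈ interior M)
    (h0 : side c v x z = 0) {ε : ℝ} (hε : ε ≠ 0) (h : ∀ y ∈ M, 0 ≤ ε * side c v x y) :
    drift c v x = 0 := by
  let n : Plane := !₂[-drift c v x 1, drift c v x 0]
  have hcont : Continuous fun δ : ℝ => z + (δ * ε) • n := by fun_prop
  have hmem : ∀ᶠ δ : ℝ in 𝓝 0, z + (δ * ε) • n ∈ interior M :=
    hcont.continuousAt.eventually_mem (isOpen_interior.mem_nhds (by simpa using hz))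
  obtain ⟨δ, hδ, hδ0⟩ := (hmem.filter_mono nhdsWithin_le_nhds |>.and
    (self_mem_nhdsWithin : Iio (0 : ℝ) ∈ 𝓝[<] 0)).exists
  have hs := h _ (interior_subset hδ)
  have hδ0' : δ < 0 := hδ0
  have hval : ε * side c v x (z + (δ * ε) • n)
      = δ * ε ^ 2 * (drift c v x 0 ^ 2 + drift c v x 1 ^ 2) := by
    unfold side at h0 ⊢
    simp [n]
    linear_combination ε * h0
  rw [hval] at hs
  have hneg : δ * ε ^ 2 < 0 := mul_neg_of_neg_of_pos hδ0' (by positivity)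
  have hsum : drift c v x 0 ^ 2 + drift c v x 1 ^ 2 ≤ 0 := by
    by_contra hpos
    push Not at hpos
    nlinarith
  exact Plane.eq_zero_of_sq_add_sq_nonpos hsum

/-- Any linear functional turns `side` into a difference of fractions. -/
theorem side_mul_cocycle (c : ℝ) (v x₀ x y : Plane) (φ : Plane →L[ℝ] ℝ) :
    side c v x₀ y * φ (drift c v x) - side c v x₀ x * φ (drift c v y)
      = side c v x y * φ (drift c v x₀) := by
  have hφ : ∀ w : Plane, φ w = w 0 * φ (EuclideanSpace.single 0 1)
      + w 1 * φ (EuclideanSpace.single 1 1) := fun w => by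
    conv_lhs => rw [show w = w 0 • EuclideanSpace.single 0 (1 : ℝ)
      + w 1 • EuclideanSpace.single 1 (1 : ℝ) from Plane.ext_coord (by simp) (by simp)]
    simp
  rw [hφ, hφ (drift c v y), hφ (drift c v x₀)]
  simp [side, drift]
  ring

theorem drift_combo (c : ℝ) (v x y : Plane) {a b : ℝ} (h : a + b = 1) :
    drift c v (a • x + b • y) = a • drift c v x + b • drift c v y := by
  obtain rfl : b = 1 - a := by linarith
  unfold drift
  module

/-- The map `x ↦ c • x + v` as a homeomorphism. -/
noncomputable def homothety {c : ℝ} (hc : c ≠ 0) (v : Plane) : Plane ≃ₜ Plane :=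
  (Homeomorph.smulOfNeZero c hc).trans (Homeomorph.addRight v)

theorem homothety_apply {c : ℝ} (hc : c ≠ 0) (v x : Plane) : homothety hc v x = c • x + v := rfl

theorem homothety_eq_add_drift {c : ℝ} (hc : c ≠ 0) (v x : Plane) :
    homothety hc v x = x + drift c v x := by
  rw [homothety_apply, drift]
  module

theorem drift_homothety {c : ℝ} (hc : c ≠ 0) (v x : Plane) :
    drift c v (homothety hc v x) = c • drift c v x := by
  rw [homothety_apply, drift, drift]
  module

theorem homothety_symm_add_smul_drift {c : ℝ} (hc : c ≠ 0) (v x : Plane) (t : ℝ) :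
    (homothety hc v).symm (x + t • drift c v x) = x + ((t - 1) / c) • drift c v x := by
  rw [Homeomorph.symm_apply_eq, homothety_apply, smul_add, smul_smul, mul_div_cancel₀ _ hc, drift]
  module

theorem convex_homothety_image {c : ℝ} (hc : c ≠ 0) (v : Plane) {K : Set Plane}
    (hK : Convex ℝ K) : Convex ℝ (homothety hc v '' K) := by
  have h : homothety hc v '' K = (fun x => v + c • x) '' K :=
    image_congr fun x _ => by rw [homothety_apply, add_comm]
  rw [h]
  exact hK.affinity v c

theorem eq_of_drift_eq_zero {c : ℝ} {v x y : Plane} (hne : ¬(c = 1 ∧ v = 0))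
    (hx : drift c v x = 0) (hy : drift c v y = 0) : x = y := by
  have h : (c - 1) • (x - y) = 0 := by
    rw [show (c - 1) • (x - y) = drift c v x - drift c v y by unfold drift; module, hx, hy, sub_zero]
  rcases smul_eq_zero.1 h with h | h
  · have hc : c = 1 := by linarith
    subst hc
    exact absurd ⟨rfl, by simpa [drift] using hx⟩ hne
  · exact sub_eq_zero.1 h

theorem Convex.mem_interior_of_between {K : Set Plane} (hK : Convex ℝ K) {p w : Plane}
    {a b d : ℝ} (ha : p + a • w ∈ interior K) (hb : p + b • w ∈ K)
    (h : a < d ∧ d < b ∨ b < d ∧ d < a) : p + d • w ∈ interior K := by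
  have hab : b - a ≠ 0 := by rcases h with h | h <;> intro h' <;> linarith
  refine hK.openSegment_interior_self_subset_interior ha hb
    ⟨(b - d) / (b - a), (d - a) / (b - a), ?_, ?_, ?_, ?_⟩
  · rcases h with h | h
    · exact div_pos (by linarith) (by linarith)
    · exact div_pos_of_neg_of_neg (by linarith) (by linarith)
  · rcases h with h | h
    · exact div_pos (by linarith) (by linarith)
    · exact div_pos_of_neg_of_neg (by linarith) (by linarith)
  · field_simp
    ring
  · have h1 : (b - d) / (b - a) + (d - a) / (b - a) = 1 := by
      field_simp
      ring
    have h2 : (b - d) / (b - a) * a + (d - a) / (b - a) * b = d := by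
      field_simp
      ring
    calc _ = ((b - d) / (b - a) + (d - a) / (b - a)) • p
          + ((b - d) / (b - a) * a + (d - a) / (b - a) * b) • w := by module
      _ = _ := by rw [h1, h2, one_smul]

/-- The points of `M` whose lines leave all of `M` on one side, selected by the sign of `ε`. -/
def extremal (c : ℝ) (v : Plane) (M : Set Plane) (ε : ℝ) : Set Plane :=
  {x | x ∈ M ∧ ∀ y ∈ M, 0 ≤ ε * side c v x y}

theorem convex_extremal (c : ℝ) (v : Plane) {M : Set Plane} (hM : Convex ℝ M) (ε : ℝ) :
    Convex ℝ (extremal c v M ε) := by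
  intro x hx y hy a b ha hb hab
  refine ⟨hM hx.1 hy.1 ha hb hab, fun z hz => ?_⟩
  rw [side_combo_left c v z x y hab]
  nlinarith [mul_nonneg ha (hx.2 z hz), mul_nonneg hb (hy.2 z hz)]

theorem isCompact_extremal (c : ℝ) (v : Plane) {M : Set Plane} (hM : IsCompact M) (ε : ℝ) :
    IsCompact (extremal c v M ε) := by
  have : extremal c v M ε = M ∩ ⋂ y ∈ M, {x | 0 ≤ ε * side c v x y} := by
    ext x
    simp [extremal]
  rw [this]
  refine hM.inter_right (isClosed_biInter fun y _ => isClosed_le continuous_const ?_)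
  unfold side drift
  fun_prop

theorem side_eq_zero_of_mem_extremal {c : ℝ} {v : Plane} {M : Set Plane} {ε : ℝ} (hε : ε ≠ 0)
    {x y : Plane} (hx : x ∈ extremal c v M ε) (hy : y ∈ extremal c v M ε) : side c v x y = 0 := by
  have h1 := hx.2 y hy.1
  have h2 := hy.2 x hx.1
  rw [side_swap] at h2
  have : ε * side c v x y = 0 := by linarith
  exact (mul_eq_zero.1 this).resolve_left hε

theorem collinear_extremal {c : ℝ} {v : Plane} (hne : ¬(c = 1 ∧ v = 0)) {M : Set Plane} {ε : ℝ}
    (hε : ε ≠ 0) : Collinear ℝ (extremal c v M ε) := by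
  by_cases h : ∃ x ∈ extremal c v M ε, drift c v x ≠ 0
  · obtain ⟨x, hx, hdx⟩ := h
    refine (collinear_iff_of_mem hx).2 ⟨drift c v x, fun y hy => ?_⟩
    obtain ⟨t, ht⟩ := exists_eq_add_smul_drift hdx (side_eq_zero_of_mem_extremal hε hx hy)
    exact ⟨t, by rw [ht, vadd_eq_add, add_comm]⟩
  · push Not at h
    have hsub : (extremal c v M ε).Subsingleton := fun x hx y hy =>
      eq_of_drift_eq_zero hne (h x hx) (h y hy)
    rcases hsub.eq_empty_or_singleton with h | ⟨x, h⟩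
    · exact h ▸ collinear_empty ℝ _
    · exact h ▸ collinear_singleton ℝ x

theorem ptOrSeg_extremal {c : ℝ} {v : Plane} (hne : ¬(c = 1 ∧ v = 0)) {M : Set Plane}
    (hM : Convex ℝ M) (hM' : IsCompact M) {ε : ℝ} (hε : ε ≠ 0)
    (h : (extremal c v M ε).Nonempty) : PtOrSeg (extremal c v M ε) :=
  (collinear_extremal hne hε).ptOrSeg h (convex_extremal c v hM ε) (isCompact_extremal c v hM' ε)

theorem drift_eq_zero_of_mem_extremal_inter {c : ℝ} {v x : Plane} {M : Set Plane}
    (hM : (interior M).Nonempty) (h₁ : x ∈ extremal c v M 1) (h₂ : x ∈ extremal c v M (-1)) :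
    drift c v x = 0 := by
  obtain ⟨z, hz⟩ := hM
  have e1 := h₁.2 z (interior_subset hz)
  have e2 := h₂.2 z (interior_subset hz)
  exact drift_eq_zero_of_side_nonneg hz (by linarith) one_ne_zero h₁.2

theorem mem_extremal_of_drift_eq_zero {c : ℝ} {v x : Plane} {M : Set Plane} (hx : x ∈ M)
    (h : drift c v x = 0) (ε : ℝ) : x ∈ extremal c v M ε :=
  ⟨hx, fun y _ => by rw [side_eq_zero_of_drift_eq_zero h, mul_zero]⟩

/-- A common boundary point of a convex body and its homothet is extremal. -/
theorem mem_extremal_of_mem_frontier {c : ℝ} (hc : 0 < c) {v x : Plane} {K : Set Plane}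
    (hK : Convex ℝ K) (hK' : IsClosed K)
    (hM : (interior (K ∩ homothety hc.ne' v '' K)).Nonempty) (hx : x ∈ frontier K)
    (hx' : x ∈ frontier (homothety hc.ne' v '' K)) :
    x ∈ extremal c v (K ∩ homothety hc.ne' v '' K) 1 ∪
      extremal c v (K ∩ homothety hc.ne' v '' K) (-1) := by
  set M := K ∩ homothety hc.ne' v '' K with hMdef
  rw [← Homeomorph.image_frontier, Homeomorph.image_eq_preimage_symm, mem_preimage] at hx'
  have hxK : x ∈ K := hK'.frontier_subset hx
  have hx'K := hK'.frontier_subset hx'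
  have hxM : x ∈ M := ⟨hxK, _, hx'K, by simp⟩
  by_cases hd : drift c v x = 0
  · exact Or.inl (mem_extremal_of_drift_eq_zero hxM hd 1)
  by_contra hcon
  have hMc : Convex ℝ M := hK.inter (convex_homothety_image _ v hK)
  have approx : ∀ {U : Set Plane}, IsOpen U → (U ∩ M).Nonempty → (U ∩ interior M).Nonempty := by
    rintro U hU ⟨y, hyU, hyM⟩
    have hy : y ∈ closure (interior M) := by
      rw [hMc.closure_interior_eq_closure_of_nonempty_interior hM]
      exact subset_closure hyM
    exact mem_closure_iff.1 hy U hU hyU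
  simp only [mem_union, extremal, mem_ofPred_eq, hxM, true_and, not_or, not_forall, not_le] at hcon
  obtain ⟨⟨y, hyM, hy⟩, w, hwM, hw⟩ := hcon
  obtain ⟨y', hy', hy'M⟩ := approx (isOpen_lt (continuous_side c v x) continuous_const)
    ⟨y, show side c v x y < 0 by linarith, hyM⟩
  obtain ⟨w', hw', hw'M⟩ := approx (isOpen_lt continuous_const (continuous_side c v x))
    ⟨w, show 0 < side c v x w by linarith, hwM⟩
  have hy0 : side c v x y' < 0 := hy'
  have hw0 : 0 < side c v x w' := hw'
  have hden : 0 < side c v x w' - side c v x y' := by linarith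
  have hsum : side c v x w' / (side c v x w' - side c v x y')
      + -side c v x y' / (side c v x w' - side c v x y') = 1 := by
    field_simp
    ring
  have hz := hMc.interior hy'M hw'M (div_nonneg hw0.le hden.le)
    (div_nonneg (neg_nonneg.2 hy0.le) hden.le) hsum
  have hz0 := side_combo_right c v x y' w' hsum
  rw [show side c v x w' / (side c v x w' - side c v x y') * side c v x y'
      + -side c v x y' / (side c v x w' - side c v x y') * side c v x w' = 0 by
    field_simp
    ring] at hz0
  obtain ⟨t, ht⟩ := exists_eq_add_smul_drift hd hz0
  rw [ht, hMdef, interior_inter, ← Homeomorph.image_interior] at hz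
  obtain ⟨hzK, hzL⟩ := hz
  rw [Homeomorph.image_eq_preimage_symm, mem_preimage, homothety_symm_add_smul_drift] at hzL
  have hxs := homothety_symm_add_smul_drift hc.ne' v x 0
  rw [zero_smul, add_zero] at hxs
  rw [hxs] at hx' hx'K
  have hx0 : x + (0 : ℝ) • drift c v x ∈ K := by simpa using hxK
  have hlt : (0 - 1) / c < 0 := div_neg_of_neg_of_pos (by norm_num) hc
  rcases lt_trichotomy t 0 with h | rfl | h
  · refine hx'.2 (hK.mem_interior_of_between hzL hx0 (Or.inl ⟨?_, hlt⟩))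
    gcongr
  · exact hx.2 (by simpa using hzK)
  · exact hx.2 (by simpa using hK.mem_interior_of_between hzK hx'K (Or.inr ⟨hlt, h⟩))

/-- If a point or its preimage is interior, the line through both meets the interior of the
intersection. -/
theorem exists_mem_interior_on_line {c : ℝ} (hc : c ≠ 0) {v x : Plane} {K : Set Plane}
    (hK : Convex ℝ K) (hx : homothety hc v x ∈ K) (hxK : x ∈ K)
    (h : x ∈ interior K ∨ homothety hc v x ∈ interior K) :
    ∃ z ∈ interior (K ∩ homothety hc v '' K), side c v (homothety hc v x) z = 0 := by
  rw [interior_inter, ← Homeomorph.image_interior]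
  have small : ∀ {g : ℝ → Plane} {U : Set Plane}, Continuous g → IsOpen U → g 0 ∈ U →
      ∃ τ ∈ Ioo (0 : ℝ) 1, g τ ∈ U := by
    intro g U hg hU h0
    have h1 : ∀ᶠ τ in 𝓝[>] (0 : ℝ), g τ ∈ U :=
      (hg.continuousAt.eventually_mem (hU.mem_nhds h0)).filter_mono nhdsWithin_le_nhds
    obtain ⟨τ, hτ, hτ'⟩ := (h1.and (Ioo_mem_nhdsGT one_pos)).exists
    exact ⟨τ, hτ', hτ⟩
  rcases h with h | h
  · obtain ⟨τ, hτ, hU⟩ := small (g := fun τ => homothety hc v x + (-τ) • drift c v x)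
      (by fun_prop) ((homothety hc v).isOpenMap _ isOpen_interior)
      ⟨x, h, by simp⟩
    refine ⟨_, ⟨?_, hU⟩, ?_⟩
    · rw [homothety_eq_add_drift, show x + drift c v x + (-τ) • drift c v x
        = x + (1 - τ) • drift c v x by module]
      refine hK.mem_interior_of_between (a := 0) (b := 1) (by simpa using h)
        (by rwa [one_smul, ← homothety_eq_add_drift hc]) (Or.inl ⟨?_, ?_⟩) <;> linarith [hτ.1, hτ.2]
    · rw [show (-τ) • drift c v x = (-τ / c) • drift c v (homothety hc v x) by
        rw [drift_homothety, smul_smul, div_mul_cancel₀ _ hc]]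
      exact side_add_smul_drift _ _ _ _
  · obtain ⟨τ, hτ, hU⟩ := small (g := fun τ => homothety hc v (x + τ • drift c v x))
      ((homothety hc v).continuous.comp (by fun_prop)) isOpen_interior (by simpa using h)
    refine ⟨_, ⟨hU, _, ?_, rfl⟩, ?_⟩
    · refine hK.mem_interior_of_between (a := 1) (b := 0)
        (by rwa [one_smul, ← homothety_eq_add_drift hc]) (by simpa using hxK) (Or.inr hτ)
    · rw [show homothety hc v (x + τ • drift c v x)
          = homothety hc v x + τ • drift c v (homothety hc v x) by
        rw [drift_homothety, homothety_apply, homothety_apply]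
        module]
      exact side_add_smul_drift _ _ _ _

theorem mem_frontier_of_mem_extremal {c : ℝ} (hc : c ≠ 0) {v x : Plane} {K : Set Plane}
    (hK : Convex ℝ K) (hd : drift c v x ≠ 0) {ε : ℝ} (hε : ε ≠ 0)
    (hx : x ∈ extremal c v (K ∩ homothety hc v '' K) ε) :
    x ∈ frontier K ∩ frontier (homothety hc v '' K) := by
  obtain ⟨hxK, x', hx', rfl⟩ := hx.1
  have key : ¬(x' ∈ interior K ∨ homothety hc v x' ∈ interior K) := fun h => by
    obtain ⟨z, hz, hz0⟩ := exists_mem_interior_on_line hc hK hxK hx' h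
    exact hd (drift_eq_zero_of_side_nonneg hz hz0 hε hx.2)
  rw [not_or] at key
  refine ⟨⟨subset_closure hxK, key.2⟩, ?_⟩
  rw [← Homeomorph.image_frontier]
  exact ⟨x', ⟨subset_closure hx', key.1⟩, rfl⟩

theorem mem_frontier_homothety_of_drift_eq_zero {c : ℝ} (hc : c ≠ 0) {v x : Plane} {K : Set Plane}
    (hd : drift c v x = 0) (hx : x ∈ frontier K) : x ∈ frontier (homothety hc v '' K) := by
  rw [← Homeomorph.image_frontier]
  exact ⟨x, hx, by rw [homothety_eq_add_drift, hd, add_zero]⟩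

theorem frontier_inter_eq_extremal_union {c : ℝ} (hc : 0 < c) {v : Plane} {K : Set Plane}
    (hK : Convex ℝ K) (hK' : IsClosed K)
    (hM : (interior (K ∩ homothety hc.ne' v '' K)).Nonempty)
    (hfix : ∀ x ∈ interior K, drift c v x ≠ 0) :
    frontier K ∩ frontier (homothety hc.ne' v '' K) =
      extremal c v (K ∩ homothety hc.ne' v '' K) 1 ∪
        extremal c v (K ∩ homothety hc.ne' v '' K) (-1) := by
  have key : ∀ {ε : ℝ}, ε ≠ 0 → extremal c v (K ∩ homothety hc.ne' v '' K) ε ⊆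
      frontier K ∩ frontier (homothety hc.ne' v '' K) := by
    intro ε hε x hx
    by_cases hd : drift c v x = 0
    · have hxF : x ∈ frontier K := ⟨subset_closure hx.1.1, fun h => hfix x h hd⟩
      exact ⟨hxF, mem_frontier_homothety_of_drift_eq_zero hc.ne' hd hxF⟩
    · exact mem_frontier_of_mem_extremal hc.ne' hK hd hε hx
  exact Subset.antisymm (fun x hx => mem_extremal_of_mem_frontier hc hK hK' hM hx.1 hx.2)
    (union_subset (key one_ne_zero) (key (by norm_num)))

theorem extremal_nonempty {c : ℝ} {v : Plane} {M : Set Plane} (hM : Convex ℝ M)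
    (hM' : IsCompact M) (hne : M.Nonempty) (hfix : ∀ x ∈ M, drift c v x ≠ 0) :
    (extremal c v M 1).Nonempty ∧ (extremal c v M (-1)).Nonempty := by
  have hconv : Convex ℝ (drift c v '' M) := by
    rintro _ ⟨x, hx, rfl⟩ _ ⟨y, hy, rfl⟩ a b ha hb hab
    exact ⟨_, hM hx hy ha hb hab, drift_combo c v x y hab⟩
  obtain ⟨φ, u, hu0, hu⟩ := geometric_hahn_banach_point_closed (x := 0) hconv
    (hM'.image (continuous_drift c v)).isClosed (by rintro ⟨x, hx, h⟩; exact hfix x hx h)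
  rw [map_zero] at hu0
  have hpos : ∀ x ∈ M, 0 < φ (drift c v x) := fun x hx => hu0.trans (hu _ ⟨x, hx, rfl⟩)
  obtain ⟨x₀, hx₀⟩ := hne
  have hcont : ContinuousOn (fun x => side c v x₀ x / φ (drift c v x)) M :=
    (continuous_side c v x₀).continuousOn.div
      (φ.continuous.comp (continuous_drift c v)).continuousOn fun x hx => (hpos x hx).ne'
  have key : ∀ x ∈ M, ∀ y ∈ M, side c v x₀ x / φ (drift c v x) ≤ side c v x₀ y / φ (drift c v y) →
      0 ≤ side c v x y := by
    intro x hx y hy h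
    rw [div_le_div_iff₀ (hpos x hx) (hpos y hy)] at h
    have := side_mul_cocycle c v x₀ x y φ
    exact nonneg_of_mul_nonneg_left (by linarith) (hpos x₀ hx₀)
  constructor
  · obtain ⟨x, hx, hmin⟩ := hM'.exists_isMinOn ⟨x₀, hx₀⟩ hcont
    exact ⟨x, hx, fun y hy => by rw [one_mul]; exact key x hx y hy (hmin hy)⟩
  · obtain ⟨x, hx, hmax⟩ := hM'.exists_isMaxOn ⟨x₀, hx₀⟩ hcont
    refine ⟨x, hx, fun y hy => ?_⟩
    rw [side_swap]
    have := key y hy x hx (hmax hy)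
    linarith

/-- A fixed point is an endpoint of the extremal set. -/
theorem extremal_eq_segment_of_fixed {c : ℝ} {v p : Plane} (hne : ¬(c = 1 ∧ v = 0)) {M : Set Plane}
    (hM : Convex ℝ M) (hM' : IsCompact M) (hint : (interior M).Nonempty) (hp : p ∈ M)
    (hd : drift c v p = 0) {ε : ℝ} (hε : ε ≠ 0) : ∃ a, extremal c v M ε = segment ℝ p a := by
  have hpE := mem_extremal_of_drift_eq_zero hp hd ε
  obtain ⟨a, b, hab⟩ := (ptOrSeg_extremal hne hM hM' hε ⟨p, hpE⟩).exists_segment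
  have haE : a ∈ extremal c v M ε := hab ▸ left_mem_segment ℝ a b
  have hbE : b ∈ extremal c v M ε := hab ▸ right_mem_segment ℝ a b
  rw [hab, ← insert_endpoints_openSegment] at hpE
  rcases hpE with rfl | rfl | ⟨s, t, hs, ht, hst, rfl⟩
  · exact ⟨b, hab⟩
  · exact ⟨a, by rw [hab, segment_symm]⟩
  · obtain ⟨z, hz⟩ := hint
    have hzero : ∀ y ∈ M, ε * side c v a y = 0 ∧ ε * side c v b y = 0 := fun y hy => by
      have h0 := side_combo_left c v y a b hst
      rw [side_eq_zero_of_drift_eq_zero hd] at h0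
      have ha := haE.2 y hy
      have hb := hbE.2 y hy
      have h1 : s * (ε * side c v a y) + t * (ε * side c v b y) = 0 := by
        linear_combination (-ε) * h0
      have h2 := mul_nonneg hs.le ha
      have h3 := mul_nonneg ht.le hb
      exact ⟨(mul_eq_zero.1 (show s * (ε * side c v a y) = 0 by linarith)).resolve_left hs.ne',
        (mul_eq_zero.1 (show t * (ε * side c v b y) = 0 by linarith)).resolve_left ht.ne'⟩
    have hzM := hzero z (interior_subset hz)
    have hda : drift c v a = 0 := drift_eq_zero_of_side_nonneg hz
      ((mul_eq_zero.1 hzM.1).resolve_left hε) hε fun y hy => (hzero y hy).1.ge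
    have hdb : drift c v b = 0 := drift_eq_zero_of_side_nonneg hz
      ((mul_eq_zero.1 hzM.2).resolve_left hε) hε fun y hy => (hzero y hy).2.ge
    obtain rfl := eq_of_drift_eq_zero hne hda hdb
    refine ⟨a, ?_⟩
    rw [hab, ← add_smul, hst, one_smul]

theorem outcome3_of_ptOrSeg {S₁ S₂ : Set Plane} (h : PtOrSeg (S₁ ∩ S₂)) : Outcome3 S₁ S₂ := by
  refine ⟨?_, Or.inl h⟩
  obtain ⟨a, b, hab⟩ := h.exists_segment
  rw [hab]
  exact (convex_segment a b).isConnected ⟨a, left_mem_segment ℝ a b⟩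

theorem segment_union_segment_of_mem {a b p : Plane} (h : p ∈ segment ℝ a b) :
    segment ℝ a p ∪ segment ℝ p b = segment ℝ a b := by
  refine Subset.antisymm (union_subset ((convex_segment a b).segment_subset
    (left_mem_segment ℝ a b) h) ((convex_segment a b).segment_subset h
    (right_mem_segment ℝ a b))) ?_
  rw [← insert_endpoints_openSegment ℝ a b, insert_subset_iff, insert_subset_iff]
  refine ⟨Or.inl (left_mem_segment ℝ a p), Or.inr (right_mem_segment ℝ p b), ?_⟩
  rw [segment_eq_image_lineMap] at h
  refine (openSegment_subset_union a b (image_subset_range _ _ h)).trans (insert_subset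
    (Or.inl (right_mem_segment ℝ a p))
    (union_subset_union (openSegment_subset_segment ℝ a p) (openSegment_subset_segment ℝ p b)))

theorem outcome3_of_segment_union {S₁ S₂ : Set Plane} {p a b : Plane}
    (hS : S₁ ∩ S₂ = segment ℝ p a ∪ segment ℝ p b)
    (hinter : segment ℝ p a ∩ segment ℝ p b ⊆ {p}) : Outcome3 S₁ S₂ := by
  by_cases ha : a = p
  · apply outcome3_of_ptOrSeg
    rw [hS, ha, segment_same, union_eq_self_of_subset_left (by simpa using left_mem_segment ℝ p b)]
    exact ptOrSeg_segment p b
  by_cases hb : b = p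
  · apply outcome3_of_ptOrSeg
    rw [hS, hb, segment_same, union_eq_self_of_subset_right (by simpa using left_mem_segment ℝ p a)]
    exact ptOrSeg_segment p a
  by_cases hcol : Collinear ℝ ({a, p, b} : Set Plane)
  · rcases hcol.wbtw_or_wbtw_or_wbtw with h | h | h
    · apply outcome3_of_ptOrSeg
      rw [hS, segment_symm ℝ p a, segment_union_segment_of_mem (mem_segment_iff_wbtw.2 h)]
      exact ptOrSeg_segment a b
    · exact absurd (hinter ⟨mem_segment_iff_wbtw.2 h, right_mem_segment ℝ p b⟩) hb
    · exact absurd (hinter ⟨right_mem_segment ℝ p a, by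
        rw [segment_symm]; exact mem_segment_iff_wbtw.2 h⟩) ha
  · refine ⟨?_, Or.inr ⟨a, p, b, ha, Ne.symm hb, ?_, hcol, by rw [hS, segment_symm ℝ p a]⟩⟩
    · rw [hS]
      exact IsConnected.union ⟨p, left_mem_segment ℝ p a, left_mem_segment ℝ p b⟩
        ((convex_segment p a).isConnected ⟨p, left_mem_segment ℝ p a⟩)
        ((convex_segment p b).isConnected ⟨p, left_mem_segment ℝ p b⟩)
    · rintro rfl
      exact ha (hinter ⟨right_mem_segment ℝ p a, right_mem_segment ℝ p a⟩)

theorem outcome_of_not_identity {c : ℝ} (hc : 0 < c) {v : Plane} (hne : ¬(c = 1 ∧ v = 0))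
    {K : Set Plane} (hK : Convex ℝ K) (hK' : IsCompact K) (hint : (interior K).Nonempty) :
    Outcome1 (frontier K) (frontier (homothety hc.ne' v '' K)) ∨
      Outcome3 (frontier K) (frontier (homothety hc.ne' v '' K)) ∨
      Outcome4 (frontier K) (frontier (homothety hc.ne' v '' K)) := by
  have hL : Convex ℝ (homothety hc.ne' v '' K) := convex_homothety_image _ v hK
  have hL' : IsCompact (homothety hc.ne' v '' K) := hK'.image (homothety hc.ne' v).continuous
  have hLint : (interior (homothety hc.ne' v '' K)).Nonempty := by
    rw [← Homeomorph.image_interior]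
    exact hint.image _
  have hM := hK.inter hL
  have hM' := hK'.inter hL'
  rcases (interior (K ∩ homothety hc.ne' v '' K)).eq_empty_or_nonempty with hemp | hMint
  · have hT : frontier K ∩ frontier (homothety hc.ne' v '' K) = K ∩ homothety hc.ne' v '' K := by
      refine Subset.antisymm (inter_subset_inter hK'.isClosed.frontier_subset
        hL'.isClosed.frontier_subset) fun x hx => ?_
      have disj : ∀ {P Q : Set Plane}, Convex ℝ Q → (interior Q).Nonempty → interior (P ∩ Q) = ∅ →
          x ∈ Q → x ∉ interior P := by
        intro P Q hQ hQi hPQ hxQ hxP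
        have hxc : x ∈ closure (interior Q) := by
          rw [hQ.closure_interior_eq_closure_of_nonempty_interior hQi]
          exact subset_closure hxQ
        obtain ⟨y, hy⟩ := mem_closure_iff.1 hxc _ isOpen_interior hxP
        rw [← interior_inter, hPQ] at hy
        exact hy
      exact ⟨⟨subset_closure hx.1, disj hL hLint hemp hx.2⟩,
        ⟨subset_closure hx.2, disj hK hint (by rwa [inter_comm]) hx.1⟩⟩
    rcases (K ∩ homothety hc.ne' v '' K).eq_empty_or_nonempty with h0 | h0
    · exact Or.inl (hT.trans h0)
    · refine Or.inr (Or.inl (outcome3_of_ptOrSeg ?_))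
      rw [hT]
      exact (hM.collinear_of_interior_eq_empty hemp).ptOrSeg h0 hM hM'
  by_cases hfix : ∃ p ∈ K, drift c v p = 0
  · obtain ⟨p, hp, hd⟩ := hfix
    have hFp : homothety hc.ne' v p = p := by rw [homothety_eq_add_drift, hd, add_zero]
    by_cases hpi : p ∈ interior K
    · left
      refine eq_empty_of_forall_notMem fun x hx => ?_
      have hpM : p ∈ interior (K ∩ homothety hc.ne' v '' K) := by
        rw [interior_inter, ← Homeomorph.image_interior]
        exact ⟨hpi, p, hpi, hFp⟩
      have hs : side c v x p = 0 := by
        rw [side_swap, side_eq_zero_of_drift_eq_zero hd, neg_zero]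
      have hdx : drift c v x = 0 := by
        rcases mem_extremal_of_mem_frontier hc hK hK'.isClosed hMint hx.1 hx.2 with h | h
        · exact drift_eq_zero_of_side_nonneg hpM hs one_ne_zero h.2
        · exact drift_eq_zero_of_side_nonneg hpM hs (by norm_num) h.2
      rw [eq_of_drift_eq_zero hne hdx hd] at hx
      exact hx.1.2 hpi
    · have hT := frontier_inter_eq_extremal_union hc hK hK'.isClosed hMint
        fun x hx hdx => hpi (by rwa [eq_of_drift_eq_zero hne hd hdx])
      have hpM : p ∈ K ∩ homothety hc.ne' v '' K := ⟨hp, p, hp, hFp⟩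
      obtain ⟨a, ha⟩ := extremal_eq_segment_of_fixed hne hM hM' hMint hpM hd one_ne_zero
      obtain ⟨b, hb⟩ := extremal_eq_segment_of_fixed hne hM hM' hMint hpM hd
        (ε := -1) (by norm_num)
      refine Or.inr (Or.inl (outcome3_of_segment_union (p := p) (by rw [hT, ha, hb]) ?_))
      rw [← ha, ← hb]
      exact fun x hx => eq_of_drift_eq_zero hne
        (drift_eq_zero_of_mem_extremal_inter hMint hx.1 hx.2) hd
  · push Not at hfix
    have hT := frontier_inter_eq_extremal_union hc hK hK'.isClosed hMint
      fun x hx => hfix x (interior_subset hx)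
    obtain ⟨hA, hB⟩ := extremal_nonempty hM hM' (hMint.mono interior_subset)
      fun x hx => hfix x hx.1
    refine Or.inr (Or.inr ⟨_, _, hA, hB, ?_, hT, ptOrSeg_extremal hne hM hM' one_ne_zero hA,
      ptOrSeg_extremal hne hM hM' (by norm_num) hB⟩)
    exact Set.disjoint_left.2 fun x h₁ h₂ =>
      hfix x h₁.1.1 (drift_eq_zero_of_mem_extremal_inter hMint h₁ h₂)

theorem Outcome3.not_outcome4 {S₁ S₂ : Set Plane} (h : Outcome3 S₁ S₂) : ¬Outcome4 S₁ S₂ := by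
  rintro ⟨A, B, hA, hB, hd, hT, hA', hB'⟩
  obtain ⟨a, b, rfl⟩ := hA'.exists_segment
  obtain ⟨a', b', rfl⟩ := hB'.exists_segment
  have hconn := h.1.isPreconnected
  rw [hT] at hconn
  obtain ⟨x, -, hx⟩ := isPreconnected_closed_iff.1 hconn _ _ (isCompact_segment a b).isClosed
    (isCompact_segment a' b').isClosed Subset.rfl (by rwa [union_inter_cancel_left])
    (by rwa [union_inter_cancel_right])
  exact disjoint_left.1 hd hx.1 hx.2

theorem Outcome3.exists_segment_union {S₁ S₂ : Set Plane} (h : Outcome3 S₁ S₂) :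
    ∃ a b c d, S₁ ∩ S₂ = segment ℝ a b ∪ segment ℝ c d := by
  rcases h.2 with h | ⟨a, b, c, -, -, -, -, h⟩
  · obtain ⟨a, b, h⟩ := h.exists_segment
    exact ⟨a, b, a, b, by rw [h, union_self]⟩
  · exact ⟨a, b, b, c, h⟩

theorem Outcome4.exists_segment_union {S₁ S₂ : Set Plane} (h : Outcome4 S₁ S₂) :
    ∃ a b c d, S₁ ∩ S₂ = segment ℝ a b ∪ segment ℝ c d := by
  obtain ⟨A, B, -, -, -, hT, hA, hB⟩ := h
  obtain ⟨a, b, rfl⟩ := hA.exists_segment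
  obtain ⟨c, d, rfl⟩ := hB.exists_segment
  exact ⟨a, b, c, d, hT⟩

theorem frontier_ne_segment_union {K : Set Plane} (hK : IsCompact K)
    (hint : (interior K).Nonempty) (a b c d : Plane) :
    frontier K ≠ segment ℝ a b ∪ segment ℝ c d :=
  frontier_ne_union_of_convex hK hint (convex_segment a b) (isCompact_segment a b).isClosed
    (convex_segment c d) (isCompact_segment c d).isClosed

end

/-- Theorem on intersecting circles: let `D₁ ⊆ ℝ²` be a convex body,
`c > 0`, `v ∈ ℝ²`, `f x = c•x + v`, `D₂ = f '' D₁`, and let `S₁, S₂` be the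
frontiers of `D₁, D₂`.  Then exactly one of the four outcomes holds. -/
theorem stmt_1 (D₁ : Set (EuclideanSpace ℝ (Fin 2)))
    (hconv : Convex ℝ D₁) (hcomp : IsCompact D₁) (hint : (interior D₁).Nonempty)
    (c : ℝ) (hc : 0 < c) (v : EuclideanSpace ℝ (Fin 2))
    (f : EuclideanSpace ℝ (Fin 2) → EuclideanSpace ℝ (Fin 2))
    (hf : ∀ x, f x = c • x + v)
    (D₂ : Set (EuclideanSpace ℝ (Fin 2))) (hD₂ : D₂ = f '' D₁)
    (S₁ S₂ : Set (EuclideanSpace ℝ (Fin 2)))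
    (hS₁ : S₁ = frontier D₁) (hS₂ : S₂ = frontier D₂) :
    (Outcome1 S₁ S₂ ∧ ¬ Outcome2 S₁ S₂ ∧ ¬ Outcome3 S₁ S₂ ∧ ¬ Outcome4 S₁ S₂) ∨
    (¬ Outcome1 S₁ S₂ ∧ Outcome2 S₁ S₂ ∧ ¬ Outcome3 S₁ S₂ ∧ ¬ Outcome4 S₁ S₂) ∨
    (¬ Outcome1 S₁ S₂ ∧ ¬ Outcome2 S₁ S₂ ∧ Outcome3 S₁ S₂ ∧ ¬ Outcome4 S₁ S₂) ∨
    (¬ Outcome1 S₁ S₂ ∧ ¬ Outcome2 S₁ S₂ ∧ ¬ Outcome3 S₁ S₂ ∧ Outcome4 S₁ S₂) := by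
  have not1 : S₁ = S₂ → ¬Outcome1 S₁ S₂ := fun h h1 => by
    rw [Outcome1, ← h, Set.inter_self, hS₁] at h1
    exact frontier_ne_union_of_convex hcomp hint convex_empty isClosed_empty convex_empty
      isClosed_empty (by rw [h1, Set.union_self])
  have not3 : S₁ = S₂ → ¬Outcome3 S₁ S₂ := fun h h3 => by
    obtain ⟨a, b, a', b', hT⟩ := h3.exists_segment_union
    rw [← h, Set.inter_self, hS₁] at hT
    exact frontier_ne_segment_union hcomp hint a b a' b' hT
  have not4 : S₁ = S₂ → ¬Outcome4 S₁ S₂ := fun h h4 => by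
    obtain ⟨a, b, a', b', hT⟩ := h4.exists_segment_union
    rw [← h, Set.inter_self, hS₁] at hT
    exact frontier_ne_segment_union hcomp hint a b a' b' hT
  have h13 : Outcome1 S₁ S₂ → ¬Outcome3 S₁ S₂ := fun h1 h3 => h3.1.nonempty.ne_empty h1
  have h14 : Outcome1 S₁ S₂ → ¬Outcome4 S₁ S₂ := by
    rintro h1 ⟨A, B, hA, -, -, hT, -, -⟩
    rw [Outcome1, hT, Set.union_empty_iff] at h1
    exact hA.ne_empty h1.1
  have h34 : Outcome3 S₁ S₂ → ¬Outcome4 S₁ S₂ := Outcome3.not_outcome4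
  have hex : Outcome1 S₁ S₂ ∨ Outcome2 S₁ S₂ ∨ Outcome3 S₁ S₂ ∨ Outcome4 S₁ S₂ := by
    have hfF : f = homothety hc.ne' v := funext fun x => by rw [hf, homothety_apply]
    by_cases hid : c = 1 ∧ v = 0
    · right; left
      have hfid : f = id := funext fun x => by simp [hf, hid.1, hid.2]
      rw [Outcome2, hS₁, hS₂, hD₂, hfid, Set.image_id]
    · rw [hS₁, hS₂, hD₂, hfF]
      rcases outcome_of_not_identity hc hid hconv hcomp hint with h | h | h
      · exact Or.inl h
      · exact Or.inr (Or.inr (Or.inl h))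
      · exact Or.inr (Or.inr (Or.inr h))
  rcases hex with h | h | h | h
  · exact Or.inl ⟨h, fun h2 => not1 h2 h, h13 h, h14 h⟩
  · exact Or.inr (Or.inl ⟨not1 h, h, not3 h, not4 h⟩)
  · exact Or.inr (Or.inr (Or.inl ⟨fun h1 => h13 h1 h, fun h2 => not3 h2 h, h, h34 h⟩))
  · exact Or.inr (Or.inr (Or.inr ⟨fun h1 => h14 h1 h, fun h2 => not4 h2 h, fun h3 => h34 h3 h, h⟩))
end

section
/- Let V be a real normed vector space and let w ∈ V be a nonzero rotund point. Then for every v ∈ V, ‖v + w‖ = ‖v‖ + ‖w‖ holds if and only if v = (‖v‖/‖w‖)•w. -/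
/-- If the triangle inequality is an equality for `v` and `w`, it remains one after scaling `v` by a
nonnegative factor. -/
theorem norm_smul_add_eq_of_norm_add_eq {V : Type*} [SeminormedAddCommGroup V] [NormedSpace ℝ V]
    {v w : V} (h : ‖v + w‖ = ‖v‖ + ‖w‖) {t : ℝ} (ht : 0 ≤ t) :
    ‖t • v + w‖ = t * ‖v‖ + ‖w‖ := by
  apply le_antisymm
  · simpa [norm_smul, abs_of_nonneg ht] using norm_add_le (t • v) w
  · rcases le_total t 1 with h1 | h1
    · have key := norm_add_le (t • v + w) ((1 - t) • v)
      rw [show t • v + w + (1 - t) • v = v + w by module, h, norm_smul,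
        Real.norm_of_nonneg (sub_nonneg.2 h1)] at key
      linarith
    · have key := norm_add_le (t • v + w) ((t - 1) • w)
      rw [show t • v + w + (t - 1) • w = t • (v + w) by module, norm_smul, norm_smul, h,
        Real.norm_of_nonneg ht, Real.norm_of_nonneg (sub_nonneg.2 h1)] at key
      linarith

/-- If `w` is a nonzero rotund point of a real normed vector space `V`
(i.e. `‖u‖ = ‖w‖` and `‖(u+w)/2‖ = ‖w‖` imply `u = w`), then for every `v`,
`‖v+w‖ = ‖v‖+‖w‖` iff `v = (‖v‖/‖w‖)•w`. -/
theorem stmt_5 {V : Type*} [NormedAddCommGroup V] [NormedSpace ℝ V]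
    (w : V) (hw : w ≠ 0)
    (hrot : ∀ u : V, ‖u‖ = ‖w‖ → ‖((1 : ℝ) / 2) • (u + w)‖ = ‖w‖ → u = w)
    (v : V) :
    ‖v + w‖ = ‖v‖ + ‖w‖ ↔ v = (‖v‖ / ‖w‖) • w := by
  have hw0 : ‖w‖ ≠ 0 := norm_ne_zero_iff.2 hw
  constructor
  · intro h
    rcases eq_or_ne v 0 with rfl | hv
    · simp
    have hv0 : ‖v‖ ≠ 0 := norm_ne_zero_iff.2 hv
    have ht : 0 ≤ ‖w‖ / ‖v‖ := by positivity
    have hu : (‖w‖ / ‖v‖) • v = w := by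
      apply hrot
      · rw [norm_smul, Real.norm_of_nonneg ht, div_mul_cancel₀ _ hv0]
      · rw [norm_smul, norm_smul_add_eq_of_norm_add_eq h ht, div_mul_cancel₀ _ hv0]
        norm_num
        ring
    rw [← inv_div, eq_inv_smul_iff₀ (div_ne_zero hw0 hv0), hu]
  · intro h
    have hray : SameRay ℝ v w := by
      rw [h]
      exact SameRay.sameRay_nonneg_smul_left w (by positivity)
    exact hray.norm_add
end

section
/- Let V be a real normed vector space, let v ∈ V be a nonzero rotund point and let w ∈ V be nonzero. Then (‖v + w‖ = ‖v‖ + ‖w‖ or ‖v − w‖ = ‖v‖ + ‖w‖) holds if and only if there exists a real number c ≠ 0 with w = c•v; that is, the parallelism predicate Par(v, w) holds if and only if v and w span the same line through the origin. -/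
/-- Additivity of the norm on `v, w` persists when `w` is rescaled by a nonnegative factor. -/
theorem norm_add_smul_of_norm_add_eq {V : Type*} [NormedAddCommGroup V] [NormedSpace ℝ V]
    {v w : V} (h : ‖v + w‖ = ‖v‖ + ‖w‖) {t : ℝ} (ht : 0 ≤ t) :
    ‖v + t • w‖ = ‖v‖ + t * ‖w‖ := by
  apply le_antisymm
  · simpa [norm_smul, abs_of_nonneg ht] using norm_add_le v (t • w)
  · rcases le_total t 1 with h1 | h1
    · have e : v + t • w = (v + w) - (1 - t) • w := by module
      have key := norm_sub_norm_le (v + w) ((1 - t) • w)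
      rw [← e, h, norm_smul, Real.norm_of_nonneg (sub_nonneg.2 h1)] at key
      linarith
    · have e : v + t • w = t • (v + w) - (t - 1) • v := by module
      have key := norm_sub_norm_le (t • (v + w)) ((t - 1) • v)
      rw [← e, norm_smul, norm_smul, h, Real.norm_of_nonneg ht,
        Real.norm_of_nonneg (sub_nonneg.2 h1)] at key
      linarith

/-- If `v` is rotund and the norm is additive on `v, w`, then `w` is a positive multiple of `v`. -/
theorem exists_pos_smul_of_norm_add_eq {V : Type*} [NormedAddCommGroup V] [NormedSpace ℝ V]
    {v w : V} (hv : v ≠ 0)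
    (hrot : ∀ u : V, ‖u‖ = ‖v‖ → ‖((1 : ℝ) / 2) • (u + v)‖ = ‖v‖ → u = v)
    (hw : w ≠ 0) (h : ‖v + w‖ = ‖v‖ + ‖w‖) : ∃ c : ℝ, 0 < c ∧ w = c • v := by
  have hv' := norm_pos_iff.2 hv
  have hw' := norm_pos_iff.2 hw
  have ht : 0 < ‖v‖ / ‖w‖ := div_pos hv' hw'
  have htw : ‖v‖ / ‖w‖ * ‖w‖ = ‖v‖ := div_mul_cancel₀ _ hw'.ne'
  have hu : (‖v‖ / ‖w‖) • w = v := by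
    apply hrot
    · rw [norm_smul, Real.norm_of_nonneg ht.le, htw]
    · rw [norm_smul, add_comm, norm_add_smul_of_norm_add_eq h ht.le, htw]
      norm_num
      ring
  refine ⟨(‖v‖ / ‖w‖)⁻¹, inv_pos.2 ht, ?_⟩
  rw [eq_inv_smul_iff₀ ht.ne', hu]

/-- The norm is additive on `v` and a nonnegative multiple of `v`. -/
theorem norm_add_smul_self {V : Type*} [NormedAddCommGroup V] [NormedSpace ℝ V]
    (v : V) {c : ℝ} (hc : 0 ≤ c) : ‖v + c • v‖ = ‖v‖ + ‖c • v‖ :=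
  (SameRay.sameRay_nonneg_smul_right v hc).norm_add


/-- If `v` is a nonzero rotund point and `w ≠ 0`, then
`Par(v,w)`, i.e. `‖v+w‖ = ‖v‖+‖w‖` or `‖v-w‖ = ‖v‖+‖w‖`, holds iff
`w = c•v` for some nonzero real `c`. -/
theorem stmt_6 {V : Type*} [NormedAddCommGroup V] [NormedSpace ℝ V]
    (v : V) (hv : v ≠ 0)
    (hrot : ∀ u : V, ‖u‖ = ‖v‖ → ‖((1 : ℝ) / 2) • (u + v)‖ = ‖v‖ → u = v)
    (w : V) (hw : w ≠ 0) :
    (‖v + w‖ = ‖v‖ + ‖w‖ ∨ ‖v - w‖ = ‖v‖ + ‖w‖) ↔ ∃ c : ℝ, c ≠ 0 ∧ w = c • v := by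
  constructor
  · rintro (h | h)
    · obtain ⟨c, hc, rfl⟩ := exists_pos_smul_of_norm_add_eq hv hrot hw h
      exact ⟨c, hc.ne', rfl⟩
    · rw [sub_eq_add_neg, ← norm_neg w] at h
      obtain ⟨c, hc, hcw⟩ := exists_pos_smul_of_norm_add_eq hv hrot (neg_ne_zero.2 hw) h
      exact ⟨-c, neg_ne_zero.2 hc.ne', by rw [neg_smul, ← hcw, neg_neg]⟩
  · rintro ⟨c, -, rfl⟩
    rcases le_total 0 c with hc | hc
    · exact Or.inl (norm_add_smul_self v hc)
    · right
      simpa [sub_eq_add_neg] using norm_add_smul_self v (neg_nonneg.2 hc)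
end

section
/- Let D₁ and D₂ be convex bodies in ℝ² whose interiors are disjoint: interior(D₁) ∩ interior(D₂) = ∅. Then frontier(D₁) ∩ frontier(D₂) = D₁ ∩ D₂, and this set is either empty, a single point, or a proper closed line segment. -/
/-- A nonempty compact convex collinear set is a closed segment. -/
theorem Collinear.exists_eq_segment {E : Type*} [NormedAddCommGroup E] [NormedSpace ℝ E]
    {K : Set E} (hcol : Collinear ℝ K) (hconv : Convex ℝ K) (hcomp : IsCompact K)
    (hne : K.Nonempty) : ∃ a b : E, K = segment ℝ a b := by
  obtain ⟨p, hp⟩ := hne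
  obtain ⟨v, hv⟩ := (collinear_iff_of_mem hp).1 hcol
  by_cases hv0 : v = 0
  · refine ⟨p, p, ?_⟩
    rw [segment_same]
    refine Set.Subset.antisymm (fun x hx => ?_) (Set.singleton_subset_iff.2 hp)
    obtain ⟨r, hr⟩ := hv x hx
    simpa [hv0] using hr
  · let φ : ℝ →ᵃ[ℝ] E := AffineMap.lineMap p (p + v)
    have hφ : ∀ r, φ r = r • v + p := fun r => by simp [φ, AffineMap.lineMap_apply]
    have hemb : Topology.IsClosedEmbedding φ := by
      have h := (Homeomorph.addRight p).isClosedEmbedding.comp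
        (isClosedEmbedding_smul_left (𝕜 := ℝ) hv0)
      convert h using 1
      ext r
      simp [hφ]
    have hK : φ '' (φ ⁻¹' K) = K := by
      rw [Set.image_preimage_eq_iff]
      intro x hx
      obtain ⟨r, hr⟩ := hv x hx
      exact ⟨r, by rw [hφ, hr, vadd_eq_add]⟩
    have hcomp' : IsCompact (φ ⁻¹' K) := hemb.isCompact_preimage hcomp
    have hconv' : Convex ℝ (φ ⁻¹' K) := hconv.affine_preimage φ
    have hne' : (φ ⁻¹' K).Nonempty := ⟨0, by simpa [hφ] using hp⟩
    have hIcc := eq_Icc_of_connected_compact ⟨hne', hconv'.isPreconnected⟩ hcomp'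
    have hle : sInf (φ ⁻¹' K) ≤ sSup (φ ⁻¹' K) :=
      Real.sInf_le_sSup _ hcomp'.bddBelow hcomp'.bddAbove
    refine ⟨φ (sInf (φ ⁻¹' K)), φ (sSup (φ ⁻¹' K)), ?_⟩
    rw [← image_segment, segment_eq_Icc hle, ← hIcc, hK]

/-- A convex set with empty interior in a two-dimensional space is collinear. -/
theorem Convex.collinear_of_interior_eq_empty_s10 {E : Type*} [NormedAddCommGroup E]
    [NormedSpace ℝ E] {K : Set E} (hdim : Module.finrank ℝ E = 2) (hconv : Convex ℝ K)
    (hint : interior K = ∅) : Collinear ℝ K := by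
  have : FiniteDimensional ℝ E := Module.finite_of_finrank_eq_succ hdim
  rcases K.eq_empty_or_nonempty with rfl | hne
  · exact collinear_empty ℝ E
  rw [collinear_iff_finrank_le_one]
  have hspan : vectorSpan ℝ K ≠ ⊤ := by
    intro h
    rw [← AffineSubspace.affineSpan_eq_top_iff_vectorSpan_eq_top_of_nonempty ℝ E E hne,
      ← hconv.interior_nonempty_iff_affineSpan_eq_top] at h
    simp [hint] at h
  have := Submodule.finrank_lt hspan
  omega

/-- The interior of a set disjoint from the interior of a convex body misses the body. -/
theorem Convex.disjoint_interior_left_of_disjoint_interior {E : Type*} [NormedAddCommGroup E]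
    [NormedSpace ℝ E] {s t : Set E} (ht : Convex ℝ t) (htint : (interior t).Nonempty)
    (hdisj : Disjoint (interior s) (interior t)) : Disjoint (interior s) t :=
  (hdisj.closure_right isOpen_interior).mono_right <| by
    rw [ht.closure_interior_eq_closure_of_nonempty_interior htint]
    exact subset_closure

/-- if the interiors of two convex bodies `D₁`, `D₂` in ℝ² are
disjoint, then `frontier D₁ ∩ frontier D₂ = D₁ ∩ D₂`, and this set is empty,
a single point, or a proper closed line segment. -/
theorem stmt_10 (D₁ D₂ : Set (EuclideanSpace ℝ (Fin 2)))
    (hconv₁ : Convex ℝ D₁) (hcomp₁ : IsCompact D₁) (hint₁ : (interior D₁).Nonempty)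
    (hconv₂ : Convex ℝ D₂) (hcomp₂ : IsCompact D₂) (hint₂ : (interior D₂).Nonempty)
    (hdisj : interior D₁ ∩ interior D₂ = ∅) :
    frontier D₁ ∩ frontier D₂ = D₁ ∩ D₂ ∧
      (D₁ ∩ D₂ = ∅ ∨ (∃ x, D₁ ∩ D₂ = {x}) ∨
        ∃ a b : EuclideanSpace ℝ (Fin 2), a ≠ b ∧ D₁ ∩ D₂ = segment ℝ a b) := by
  have hd : Disjoint (interior D₁) (interior D₂) := Set.disjoint_iff_inter_eq_empty.2 hdisj
  have hd₁ := hconv₂.disjoint_interior_left_of_disjoint_interior hint₂ hd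
  have hd₂ := hconv₁.disjoint_interior_left_of_disjoint_interior hint₁ hd.symm
  constructor
  · rw [hcomp₁.isClosed.frontier_eq, hcomp₂.isClosed.frontier_eq]
    ext x
    exact ⟨fun h => ⟨h.1.1, h.2.1⟩, fun h =>
      ⟨⟨h.1, fun hx => Set.disjoint_left.1 hd₁ hx h.2⟩,
        ⟨h.2, fun hx => Set.disjoint_left.1 hd₂ hx h.1⟩⟩⟩
  · rcases (D₁ ∩ D₂).eq_empty_or_nonempty with hempty | hne
    · exact Or.inl hempty
    have hconv := hconv₁.inter hconv₂
    have hcol := hconv.collinear_of_interior_eq_empty_s10 (by simp)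
      (by rw [interior_inter, hdisj])
    obtain ⟨a, b, hab⟩ := hcol.exists_eq_segment hconv (hcomp₁.inter hcomp₂) hne
    rcases eq_or_ne a b with rfl | hne'
    · exact Or.inr (Or.inl ⟨a, by rw [hab, segment_same]⟩)
    · exact Or.inr (Or.inr ⟨a, b, hne', hab⟩)
end

section
/- Let D be a convex body in ℝ² and let v ∈ ℝ² be nonzero. Let l = {x₀ + t•v : t ∈ ℝ} be a line parallel to v (for some x₀ ∈ ℝ²). If l meets interior(D) ∩ interior(D + v) (where D + v = {x + v : x ∈ D}), then l ∩ frontier(D) ∩ frontier(D + v) = ∅. -/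
/-- If `p + u` lies in the closure of a convex set and `p - s • u` with `0 ≤ s` lies in its interior,
then `p` lies in its interior. -/
theorem Convex.mem_interior_of_add_of_sub_smul {E : Type*} [NormedAddCommGroup E] [NormedSpace ℝ E]
    {D : Set E} (hD : Convex ℝ D) {p u : E} {s : ℝ} (hs : 0 ≤ s)
    (hint : p - s • u ∈ interior D) (hcl : p + u ∈ closure D) : p ∈ interior D := by
  have h : (0 : ℝ) < 1 + s := by positivity
  have key := hD.combo_interior_closure_mem_interior hint hcl (a := 1 / (1 + s))
    (b := s / (1 + s)) (by positivity) (by positivity) (by field_simp)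
  convert key using 1
  match_scalars <;> field_simp
  ring


/-- let `D` be a convex body in ℝ², `v ≠ 0`, and let
`l = {x₀ + t•v : t ∈ ℝ}` be a line parallel to `v`.  If `l` meets
`interior D ∩ interior (D + v)`, then `l ∩ frontier D ∩ frontier (D + v) = ∅`. -/
theorem stmt_13 (D : Set (EuclideanSpace ℝ (Fin 2)))
    (hconv : Convex ℝ D) (hcomp : IsCompact D) (hint : (interior D).Nonempty)
    (v : EuclideanSpace ℝ (Fin 2)) (hv : v ≠ 0) (x₀ : EuclideanSpace ℝ (Fin 2))
    (hmeet : ({x | ∃ t : ℝ, x = x₀ + t • v} ∩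
        (interior D ∩ interior ((fun x => x + v) '' D))).Nonempty) :
    {x | ∃ t : ℝ, x = x₀ + t • v} ∩
        (frontier D ∩ frontier ((fun x => x + v) '' D)) = ∅ := by
  rw [Set.eq_empty_iff_forall_notMem]
  rintro p ⟨⟨r, hr⟩, hpD, hpDv⟩
  obtain ⟨q, ⟨t, hq⟩, hqD, hqDv⟩ := hmeet
  have himage := (Homeomorph.addRight v).image_frontier D
  have himage' := (Homeomorph.addRight v).image_interior D
  simp only [Homeomorph.coe_addRight] at himage himage'
  rw [← himage] at hpDv
  rw [← himage'] at hqDv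
  obtain ⟨p', hp', rfl⟩ := hpDv
  obtain ⟨q', hq', rfl⟩ := hqDv
  have hqp : q' = p' + (t - r) • v := by
    linear_combination (norm := module) hq - hr
  subst hqp
  rcases le_total r t with h | h
  · refine hpD.2 (hconv.mem_interior_of_add_of_sub_smul (u := -v) (sub_nonneg.2 h) ?_ ?_)
    · convert hqD using 1
      module
    · simpa using hp'.1
  · refine hp'.2 (hconv.mem_interior_of_add_of_sub_smul (u := v) (sub_nonneg.2 h) ?_ hpD.1)
    convert hq' using 1
    module
end

section
/- Let D be a convex body in ℝ² with 0 ∉ interior(D), let c > 0 be a real number with c ≠ 1, and let r = {t•u : t ≥ 0} be a ray from the origin in the direction of a nonzero vector u ∈ ℝ². If r meets interior(D) ∩ interior(c • D) (where c • D = {c•x : x ∈ D}), then r ∩ frontier(D) ∩ frontier(c • D) ⊆ {0}. -/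
open Pointwise

/-- On the line spanned by `u`, a parameter strictly between one of an interior point and one of a
point of a convex set belongs to an interior point. -/
theorem Convex.smul_mem_interior_of_mem_openSegment {E : Type*} [AddCommGroup E] [Module ℝ E]
    [TopologicalSpace E] [IsTopologicalAddGroup E] [ContinuousConstSMul ℝ E]
    {D : Set E} (hD : Convex ℝ D) {u : E} {x y z : ℝ} (hx : x • u ∈ interior D)
    (hy : y • u ∈ D) (hz : z ∈ openSegment ℝ x y) : z • u ∈ interior D := by
  obtain ⟨a, b, ha, hb, hab, rfl⟩ := hz
  refine hD.openSegment_interior_self_subset_interior hx hy ⟨a, b, ha, hb, hab, ?_⟩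
  simp only [add_smul, smul_eq_mul, mul_smul]

/-- let `D` be a convex body in ℝ² with `0 ∉ interior D`, let
`c > 0`, `c ≠ 1`, and let `r = {t•u : t ≥ 0}` be a ray from the origin in the
direction of `u ≠ 0`.  If `r` meets `interior D ∩ interior (c • D)`, then
`r ∩ frontier D ∩ frontier (c • D) ⊆ {0}`. -/
theorem stmt_14 (D : Set (EuclideanSpace ℝ (Fin 2)))
    (hconv : Convex ℝ D) (hcomp : IsCompact D) (hint : (interior D).Nonempty)
    (h0 : (0 : EuclideanSpace ℝ (Fin 2)) ∉ interior D)
    (c : ℝ) (hc : 0 < c) (hc1 : c ≠ 1)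
    (u : EuclideanSpace ℝ (Fin 2)) (hu : u ≠ 0)
    (hmeet : ({x | ∃ t : ℝ, 0 ≤ t ∧ x = t • u} ∩
        (interior D ∩ interior (c • D))).Nonempty) :
    {x | ∃ t : ℝ, 0 ≤ t ∧ x = t • u} ∩ (frontier D ∩ frontier (c • D)) ⊆
      {(0 : EuclideanSpace ℝ (Fin 2))} := by
  rintro _ ⟨⟨t, ht, rfl⟩, hq, hq'⟩
  obtain ⟨_, ⟨s, -, rfl⟩, hs, hs'⟩ := hmeet
  by_contra htu
  have ht0 : 0 < t := ht.lt_of_ne (by rintro rfl; simp at htu)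
  have hd : 0 < c⁻¹ := inv_pos.2 hc
  have hd1 : c⁻¹ ≠ 1 := inv_ne_one.2 hc1
  have hclosed : IsClosed D := hcomp.isClosed
  rw [hclosed.frontier_eq] at hq
  rw [(hcomp.smul c).isClosed.frontier_eq, interior_smul₀ hc.ne'] at hq'
  rw [interior_smul₀ hc.ne'] at hs'
  simp only [Set.mem_sdiff, Set.mem_smul_set_iff_inv_smul_mem₀ hc.ne', smul_smul] at hq hq' hs'
  generalize c⁻¹ = d at *
  have between {x y z : ℝ} (hx : x • u ∈ interior D) (hy : y • u ∈ D) (hz : z • u ∉ interior D) :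
      ¬ (x < z ∧ z < y) ∧ ¬ (y < z ∧ z < x) := by
    refine ⟨fun h => hz (hconv.smul_mem_interior_of_mem_openSegment hx hy ?_),
      fun h => hz (hconv.smul_mem_interior_of_mem_openSegment hx hy ?_)⟩
    · rwa [openSegment_eq_Ioo (h.1.trans h.2)]
    · rwa [openSegment_symm, openSegment_eq_Ioo (h.1.trans h.2)]
  have hst : s ≠ t := by rintro rfl; exact hq.2 hs
  have hsdt : s ≠ d * t := by rintro rfl; exact hq'.2 hs
  have h₁ := between hs hq'.1 hq.2
  have h₂ := between hs hq.1 hq'.2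
  have h₃ := between hs' hq.1 hq'.2
  rcases hst.lt_or_gt with h | h <;> rcases hd1.lt_or_gt with h' | h' <;>
    rcases hsdt.lt_or_gt with h'' | h'' <;>
    have := mul_lt_mul_of_pos_left h hd <;> have := mul_lt_mul_of_pos_right h' ht0 <;> grind
end

section
/- Let n be a natural number, let C be a closed subset of the euclidean unit sphere S^{n−1} = {x ∈ ℝⁿ : ‖x‖ = 1} of ℝⁿ (with the euclidean norm), and let X be the convex hull of C. Then frontier(X) ∩ S^{n−1} = C. -/
open Metric in
/-- The convex hull of a subset of a sphere of nonzero radius has no interior point in that set. -/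
theorem subset_frontier_convexHull_of_subset_sphere {E : Type*} [NormedAddCommGroup E]
    [NormedSpace ℝ E] {C : Set E} {a : E} {r : ℝ} (hr : r ≠ 0) (hC : C ⊆ sphere a r) :
    C ⊆ frontier (convexHull ℝ C) := by
  intro x hx
  refine ⟨subset_closure (subset_convexHull ℝ C hx), fun hint => ?_⟩
  have hball : convexHull ℝ C ⊆ closedBall a r :=
    convexHull_min (hC.trans sphere_subset_closedBall) (convex_closedBall a r)
  have hxball := interior_mono hball hint
  rw [interior_closedBall a hr, mem_ball] at hxball
  exact hxball.ne (hC hx)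

/-- The closed convex hull of a closed subset of the unit sphere meets the sphere only in
that subset. -/
theorem mem_of_mem_closure_convexHull_of_norm_eq_one {E : Type*} [NormedAddCommGroup E]
    [InnerProductSpace ℝ E] {C : Set E} (hC : IsClosed C) (hCs : ∀ c ∈ C, ‖c‖ = 1) {x : E}
    (hx : x ∈ closure (convexHull ℝ C)) (hx1 : ‖x‖ = 1) : x ∈ C := by
  by_contra hxC
  obtain ⟨ε, hε, hball⟩ := Metric.isOpen_iff.1 hC.isOpen_compl x hxC
  have hhalf : closure (convexHull ℝ C) ⊆ {y | inner ℝ x y ≤ 1 - ε ^ 2 / 2} := by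
    refine closure_minimal (convexHull_min (fun c hc => ?_) ?_) ?_
    · have hdist : ε ≤ ‖x - c‖ := by
        by_contra! hlt
        exact hball (by rwa [Metric.mem_ball, dist_comm, dist_eq_norm]) hc
      have hsq := norm_sub_sq_real x c
      rw [hx1, hCs c hc] at hsq
      have := pow_le_pow_left₀ hε.le hdist 2
      simp only [Set.mem_ofPred_eq]
      linarith
    · exact convex_halfSpace_le (innerₛₗ ℝ x).isLinear _
    · exact isClosed_le (by fun_prop) continuous_const
  have hxx := hhalf hx
  rw [Set.mem_ofPred_eq, real_inner_self_eq_norm_sq, hx1] at hxx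
  nlinarith [pow_pos hε 2]


/-- if `C` is a closed subset of the euclidean unit sphere of ℝⁿ
and `X` is its convex hull, then `frontier X ∩ S^{n-1} = C`. -/
theorem stmt_15 (n : ℕ) (C : Set (EuclideanSpace ℝ (Fin n)))
    (hC : IsClosed C) (hCs : C ⊆ {x : EuclideanSpace ℝ (Fin n) | ‖x‖ = 1}) :
    frontier (convexHull ℝ C) ∩ {x : EuclideanSpace ℝ (Fin n) | ‖x‖ = 1} = C := by
  refine Set.Subset.antisymm (fun x hx => ?_) (fun x hx => ⟨?_, hCs hx⟩)
  · exact mem_of_mem_closure_convexHull_of_norm_eq_one hC hCs hx.1.1 hx.2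
  · exact subset_frontier_convexHull_of_subset_sphere (a := 0) one_ne_zero
      (fun c hc => mem_sphere_zero_iff_norm.2 (hCs hc)) hx
end
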